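/- Let p be a prime element of 𝒪 with p ≡ 1 (mod 3), let w, B ∈ 𝒪 with wB coprime to p, and let l, k be positive integers with l ≥ k. If k > 1 then ∑_{A (p^k)*} (A/p^k)₃ · e(p^l·(wA)⁻¹/p^k) · ∑_{x (p^k)} e((A w² x³ + B x)/p^k) = 0, while if k = 1 the sum equals μ(p)·(w/p)₃·g(1,p). -/

import Mathlib

noncomputable section

namespace CubicSeries

open scoped Classical

def ω : ℂ := Complex.exp (2 * Real.pi * Complex.I / 3)

def O : Subring ℂ := Subring.closure {ω}

abbrev OK : Type _ := O

def δ : ℂ := ω - ω ^ 2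

def eC (z : ℂ) : ℂ :=
  Complex.exp (2 * Real.pi * Complex.I * (z / δ + (starRingEnd ℂ) (z / δ)))

def rep {I : Ideal OK} (x : OK ⧸ I) : OK :=
  Function.surjInv Ideal.Quotient.mk_surjective x

/-- `N(c) = |𝒪/(c)|`, the absolute norm. -/
def Nm (c : OK) : ℕ := Nat.card (OK ⧸ Ideal.span {c})

/-- `φ(c) = |(𝒪/(c))ˣ|`. -/
def totient (c : OK) : ℕ := Nat.card ((OK ⧸ Ideal.span {c})ˣ)

/-- a multiplicative inverse modulo `c` (an arbitrary element when `x` is not invertible). -/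
def invMod (c x : OK) : OK :=
  rep (Ring.inverse (Ideal.Quotient.mk (Ideal.span {c}) x))

def T (A B c : OK) : ℂ :=
  ∑ᶠ x : OK ⧸ Ideal.span {c}, eC (((A * rep x ^ 3 + B * rep x : OK) : ℂ) / (c : ℂ))

/-- The cubic residue symbol `(x/π)₃` for a prime element `π` not dividing `3`:
the unique cube root of unity congruent to `x^{(N(π)-1)/3}` mod `π`, and `0` if `π ∣ x`. -/
def cubicCharP (π x : OK) : OK :=
  if h : ∃ ζ : OK, ζ ^ 3 = 1 ∧ π ∣ ζ - x ^ ((Nm π - 1) / 3) ∧ ¬ π ∣ x then h.choose else 0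

/-- The cubic residue symbol `(x/c)₃` for `c` coprime to `3`, defined via a factorization of
`c` into a unit times prime elements (with multiplicity). -/
def cubicChar (c x : OK) : OK :=
  if h : ∃ fs : OKˣ × Multiset OK, (∀ π ∈ fs.2, Prime π) ∧ c = (fs.1 : OK) * fs.2.prod
  then (h.choose.2.map fun π => cubicCharP π x).prod
  else 0

/-- The cubic Gauss sum `g(a,c) = ∑_{x (c)*} (x/c)₃ e(ax/c)`. -/
def gaussSum (a c : OK) : ℂ :=
  ∑ᶠ u : (OK ⧸ Ideal.span {c})ˣ,
    ((cubicChar c (rep u.val) : OK) : ℂ) * eC (((a * rep u.val : OK) : ℂ) / (c : ℂ))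

/-- The Möbius function: `μ(c) = (−1)^r` if `(c)` is a product of `r` distinct prime ideals,
and `μ(c) = 0` otherwise. -/
def moebius (c : OK) : ℤ :=
  if h : ∃ s : Finset (Ideal OK), (∀ P ∈ s, Prime P) ∧ Ideal.span {c} = ∏ P ∈ s, P
  then (-1) ^ h.choose.card
  else 0

/-- `p^n` modulo `c`, where a negative exponent means the inverse of `p^{-n}` mod `c`. -/
def ppow (c p : OK) (n : ℤ) : OK :=
  if 0 ≤ n then p ^ n.toNat else invMod c (p ^ (-n).toNat)

/-- A choice of generator of a (principal) ideal. -/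
def gen (J : Ideal OK) : OK := if h : ∃ q : OK, Ideal.span {q} = J then h.choose else 0

/-- A choice of cofactor: `cofactor c q` is a `d` with `c = q·d`, when one exists. -/
def cofactor (c q : OK) : OK := if h : ∃ d : OK, c = q * d then h.choose else 0


/-! Abstract lemmas -/

theorem sum_char_zero {R : Type*} [CommRing R] [Fintype R] (E : R → ℂ)
    (hE : ∀ a b, E (a + b) = E a * E b) (hz : ∃ z, E z ≠ 1) : ∑ t, E t = 0 := by
  obtain ⟨z, hz⟩ := hz
  have h : ∑ t, E t = E z * ∑ t, E t := by
    rw [Finset.mul_sum, ← Equiv.sum_comp (Equiv.addLeft z)]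
    simp [hE]
  have h2 : (1 - E z) * ∑ t, E t = 0 := by linear_combination h
  rcases mul_eq_zero.1 h2 with h3 | h3
  · exact absurd (by linear_combination -h3) hz
  · exact h3

/-- shifting units by a square-zero element -/
def shiftUnits {R : Type*} [CommRing R] (n : R) (hn : n * n = 0) : Rˣ ≃ Rˣ where
  toFun u := ⟨u + n, ↑u⁻¹ - ↑u⁻¹ * ↑u⁻¹ * n, by
    linear_combination (1 - (↑u⁻¹ : R) * n) * u.mul_inv - (↑u⁻¹ : R) * (↑u⁻¹ : R) * hn, by
    linear_combination (1 - (↑u⁻¹ : R) * n) * u.mul_inv - (↑u⁻¹ : R) * (↑u⁻¹ : R) * hn⟩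
  invFun u := ⟨u - n, ↑u⁻¹ + ↑u⁻¹ * ↑u⁻¹ * n, by
    linear_combination (1 + (↑u⁻¹ : R) * n) * u.mul_inv - (↑u⁻¹ : R) * (↑u⁻¹ : R) * hn, by
    linear_combination (1 + (↑u⁻¹ : R) * n) * u.mul_inv - (↑u⁻¹ : R) * (↑u⁻¹ : R) * hn⟩
  left_inv u := by ext; simp
  right_inv u := by ext; simp

theorem abs_gt {R : Type*} [CommRing R] [Fintype R] (N w B : R) (E : R → ℂ)
    (hE : ∀ a b, E (a + b) = E a * E b) (hN : N * N = 0)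
    (hw : IsUnit w) (hB : IsUnit B) (hnu : ∀ t : R, ¬ IsUnit t → N * t = 0)
    (hz : ∃ z, E (N * z) ≠ 1) (c : Rˣ → ℂ)
    (hc : ∀ u v : Rˣ, N ∣ (u : R) - v → c u = c v) :
    ∑ u : Rˣ, c u * ∑ t : R, E (u * w ^ 2 * t ^ 3 + B * t) = 0 := by
  have hz' : ∀ b : R, IsUnit b → ∃ z, E (b * (N * z)) ≠ 1 := by
    rintro _ ⟨b, rfl⟩
    obtain ⟨z, hz⟩ := hz
    refine ⟨↑b⁻¹ * z, ?_⟩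
    convert hz using 2
    linear_combination (N * z) * b.mul_inv
  have key1 : ∀ u : Rˣ, ∑ t : R, (if IsUnit t then 0 else E (u * w ^ 2 * t ^ 3 + B * t)) = 0 := by
    intro u
    obtain ⟨z, hz⟩ := hz' B hB
    have hnz : (N * z) * (N * z) = 0 := by linear_combination z ^ 2 * hN
    set S := ∑ t : R, (if IsUnit t then 0 else E (u * w ^ 2 * t ^ 3 + B * t)) with hS
    have h : S = E (B * (N * z)) * S := by
      rw [hS, Finset.mul_sum, ← Equiv.sum_comp (Equiv.addRight (N * z))]
      refine Finset.sum_congr rfl fun t _ => ?_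
      have hiff : IsUnit (t + N * z) ↔ IsUnit t := by
        constructor
        · rintro ⟨v, hv⟩
          have := ((shiftUnits (N * z) hnz).symm v).isUnit
          convert this using 1
          simp [shiftUnits, hv]
        · rintro ⟨v, rfl⟩
          exact (shiftUnits (N * z) hnz v).isUnit
      simp only [Equiv.coe_addRight, hiff]
      split_ifs with ht
      · simp
      · rw [← hE]
        congr 1
        have := hnu t ht
        linear_combination (u * w ^ 2 * (3 * t * z + 3 * N * z ^ 2)) * this +
          u * w ^ 2 * N * z ^ 3 * hN
    have h2 : (1 - E (B * (N * z))) * S = 0 := by linear_combination h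
    rcases mul_eq_zero.1 h2 with h3 | h3
    · exact absurd (by linear_combination -h3) hz
    · exact h3
  have key2 : ∀ t : R, IsUnit t → ∑ u : Rˣ, c u * E (u * w ^ 2 * t ^ 3 + B * t) = 0 := by
    intro t ht
    obtain ⟨z, hz⟩ := hz' (w ^ 2 * t ^ 3) ((hw.pow 2).mul (ht.pow 3))
    have hnz : (N * z) * (N * z) = 0 := by linear_combination z ^ 2 * hN
    set S := ∑ u : Rˣ, c u * E (u * w ^ 2 * t ^ 3 + B * t) with hS
    have h : S = E (w ^ 2 * t ^ 3 * (N * z)) * S := by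
      rw [hS, Finset.mul_sum, ← Equiv.sum_comp (shiftUnits (N * z) hnz)]
      refine Finset.sum_congr rfl fun u _ => ?_
      rw [hc (shiftUnits (N * z) hnz u) u ⟨z, by simp [shiftUnits]⟩, mul_left_comm, ← hE]
      congr 2
      simp only [shiftUnits, Equiv.coe_fn_mk]
      ring
    have h2 : (1 - E (w ^ 2 * t ^ 3 * (N * z))) * S = 0 := by linear_combination h
    rcases mul_eq_zero.1 h2 with h3 | h3
    · exact absurd (by linear_combination -h3) hz
    · exact h3
  have split : ∀ u : Rˣ, ∑ t : R, E (u * w ^ 2 * t ^ 3 + B * t) =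
      ∑ t : R, (if IsUnit t then E (u * w ^ 2 * t ^ 3 + B * t) else 0) := by
    intro u
    have h := key1 u
    rw [← sub_eq_zero, ← Finset.sum_sub_distrib]
    refine Eq.trans (Finset.sum_congr rfl fun t _ => ?_) h
    split_ifs
    · exact sub_self _
    · exact sub_zero _
  simp only [split, Finset.mul_sum]
  rw [Finset.sum_comm]
  refine Finset.sum_eq_zero fun t _ => ?_
  by_cases ht : IsUnit t
  · simpa [ht] using key2 t ht
  · simp [ht]

theorem abs_one {F : Type*} [Field F] [Fintype F] (w B : Fˣ) (E : F → ℂ)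
    (hE : ∀ a b, E (a + b) = E a * E b) (hE0 : E 0 = 1) (hz : ∃ z, E z ≠ 1) (X : Fˣ →* ℂ)
    (hX3 : ∀ u, X u ^ 3 = 1) (hX : ∃ u, X u ≠ 1) :
    ∑ u : Fˣ, X u * ∑ t : F, E (u * w ^ 2 * t ^ 3 + B * t) =
      - X w * ∑ u : Fˣ, X u * E u := by
  have hX0 : ∑ u : Fˣ, X u = 0 := by
    obtain ⟨v, hv⟩ := hX
    have h : ∑ t, X t = X v * ∑ t, X t := by
      rw [Finset.mul_sum, ← Equiv.sum_comp (Equiv.mulLeft v)]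
      simp
    have h2 : (1 - X v) * ∑ t, X t = 0 := by linear_combination h
    rcases mul_eq_zero.1 h2 with h3 | h3
    · exact absurd (by linear_combination -h3) hv
    · exact h3
  have hsplit : ∀ f : F → ℂ, ∑ t : F, f t = f 0 + ∑ v : Fˣ, f v := by
    intro f
    rw [← Finset.add_sum_erase _ _ (Finset.mem_univ (0 : F))]
    congr 1
    symm
    refine Finset.sum_bij (fun v _ => (v : F)) ?_ ?_ ?_ ?_
    · intro v _; simp
    · intro a _ b _ h; exact Units.ext h
    · intro b hb; exact ⟨Units.mk0 b (by simpa using hb), by simp, by simp⟩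
    · intro v _; rfl
  have hB : ∑ v : Fˣ, E (B * v) = -1 := by
    have h1 := hsplit E
    rw [sum_char_zero E hE hz, hE0] at h1
    have h2 : ∑ v : Fˣ, E (B * v) = ∑ v : Fˣ, E v := by
      rw [← Equiv.sum_comp (Equiv.mulLeft B) (fun v : Fˣ => E v)]
      simp
    rw [h2]; linear_combination -h1
  have inner : ∀ v : Fˣ, ∑ u : Fˣ, X u * E (u * w ^ 2 * v ^ 3 + B * v) =
      E (B * v) * (X w * ∑ u : Fˣ, X u * E u) := by
    intro v
    rw [← Equiv.sum_comp (Equiv.mulRight (w ^ 2 * v ^ 3)) (fun u : Fˣ => X u * E u),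
      Finset.mul_sum, Finset.mul_sum]
    refine Finset.sum_congr rfl fun u _ => ?_
    simp only [Equiv.coe_mulRight, map_mul, map_pow, hE, Units.val_mul, Units.val_pow_eq_pow_val,
      ← mul_assoc]
    linear_combination -(X u * E (u * w ^ 2 * v ^ 3) * E (B * v)) * (X w ^ 3 * hX3 v + hX3 w)
  simp only [Finset.mul_sum]
  rw [Finset.sum_comm, hsplit]
  simp only [inner, ← Finset.sum_mul, hB]
  simp only [hE0, ne_eq, OfNat.ofNat_ne_zero, not_false_eq_true, zero_pow, mul_zero, add_zero,
    mul_one, hX0]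
  rw [Finset.mul_sum]
  simp only [neg_mul, one_mul, Finset.mul_sum, zero_add, Finset.sum_neg_distrib]

/-! The ring -/

theorem ω_eq : ω = ⟨-1/2, Real.sqrt 3 / 2⟩ := by
  have h : (2 * Real.pi * Complex.I / 3 : ℂ) = ((Real.pi - Real.pi / 3 : ℝ) : ℂ) * Complex.I := by
    push_cast; ring
  rw [ω, h]
  apply Complex.ext
  · rw [Complex.exp_ofReal_mul_I_re, Real.cos_pi_sub, Real.cos_pi_div_three]; norm_num
  · rw [Complex.exp_ofReal_mul_I_im, Real.sin_pi_sub, Real.sin_pi_div_three]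

theorem s3 : Real.sqrt 3 * Real.sqrt 3 = 3 := Real.mul_self_sqrt (by norm_num)
theorem s3_ne : Real.sqrt 3 ≠ 0 := by positivity

theorem ω_sq : ω ^ 2 = -1 - ω := by
  rw [ω_eq, sq]
  apply Complex.ext
  · simp; nlinarith [s3]
  · simp; ring

theorem ω_re : ω.re = -1/2 := by rw [ω_eq]
theorem ω_im : ω.im = Real.sqrt 3 / 2 := by rw [ω_eq]

theorem δ_eq : δ = Real.sqrt 3 * Complex.I := by
  rw [δ, ω_sq]
  apply Complex.ext
  · simp [ω_re]; norm_num
  · simp [ω_im]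

theorem mem_O (z : ℂ) (hz : z ∈ O) : ∃ a b : ℤ, z = a + b * ω := by
  induction hz using Subring.closure_induction with
  | mem x hx => exact ⟨0, 1, by simpa using hx⟩
  | zero => exact ⟨0, 0, by simp⟩
  | one => exact ⟨1, 0, by simp⟩
  | add x y _ _ hx hy =>
    obtain ⟨a, b, rfl⟩ := hx
    obtain ⟨c, d, rfl⟩ := hy
    exact ⟨a + c, b + d, by push_cast; ring⟩
  | neg x _ hx =>
    obtain ⟨a, b, rfl⟩ := hx
    exact ⟨-a, -b, by push_cast; ring⟩
  | mul x y _ _ hx hy =>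
    obtain ⟨a, b, rfl⟩ := hx
    obtain ⟨c, d, rfl⟩ := hy
    exact ⟨a * c - b * d, a * d + b * c - b * d, by
      push_cast; linear_combination (b * d : ℂ) * ω_sq⟩

theorem ω_mem : ω ∈ O := Subring.subset_closure rfl

theorem lin_mem (a b : ℤ) : (a + b * ω : ℂ) ∈ O :=
  O.add_mem (intCast_mem O a) (O.mul_mem (intCast_mem O b) ω_mem)

/-- `ω` as an element of the ring of integers -/
def wO : OK := ⟨ω, ω_mem⟩

theorem wO_sq : wO ^ 2 = -1 - wO := Subtype.ext (by simpa [wO] using ω_sq)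

instance finO : Module.Finite ℤ OK := by
  refine ⟨⟨{1, wO}, ?_⟩⟩
  rw [eq_top_iff]
  rintro ⟨z, hz⟩ -
  obtain ⟨a, b, rfl⟩ := mem_O z hz
  have : (⟨a + b * ω, hz⟩ : OK) = a • (1 : OK) + b • wO := Subtype.ext (by simp [wO])
  rw [this]
  exact Submodule.add_mem _ (Submodule.smul_mem _ _ (Submodule.subset_span (by simp)))
    (Submodule.smul_mem _ _ (Submodule.subset_span (by simp)))

theorem finQ (c : OK) (hc : c ≠ 0) : Finite (OK ⧸ Ideal.span {c}) :=
  Ideal.finiteQuotientOfFreeOfNeBot _ (by simpa using hc)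

/-! The additive character -/

theorem eC_eq (z : ℂ) : eC z =
    Complex.exp (2 * Real.pi * Complex.I * ((2 * z.im / Real.sqrt 3 : ℝ) : ℂ)) := by
  rw [eC, Complex.add_conj, δ_eq]
  congr 3
  have h : z / (Real.sqrt 3 * Complex.I) = (z / Complex.I) / (Real.sqrt 3 : ℝ) := by
    field_simp
  rw [h, Complex.div_ofReal_re, Complex.div_I]
  simp
  ring

theorem eC_add (x y : ℂ) : eC (x + y) = eC x * eC y := by
  rw [eC_eq, eC_eq, eC_eq, ← Complex.exp_add]
  congr 1
  simp only [Complex.add_im]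
  push_cast
  ring

theorem eC_eq_one (z : ℂ) : eC z = 1 ↔ ∃ n : ℤ, 2 * z.im / Real.sqrt 3 = n := by
  rw [eC_eq, Complex.exp_eq_one_iff]
  refine exists_congr fun n => ?_
  rw [mul_comm (n : ℂ), mul_right_inj' Complex.two_pi_I_ne_zero]
  norm_cast

theorem eC_int (z : OK) : eC (z : ℂ) = 1 := by
  obtain ⟨a, b, h⟩ := mem_O z z.2
  rw [eC_eq_one]
  refine ⟨b, ?_⟩
  rw [h]
  simp [ω_im]
  field_simp [s3_ne]

theorem eC_nondeg (c : ℂ) (h : ∀ z : OK, eC (z * c) = 1) : c ∈ O := by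
  obtain ⟨b, hb⟩ := (eC_eq_one _).1 (h 1)
  obtain ⟨a, ha⟩ := (eC_eq_one _).1 (h wO)
  have : c = ((a + b : ℤ) : ℂ) + (b : ℤ) * ω := by
    have h3 := s3
    rw [div_eq_iff s3_ne] at ha hb
    simp [wO, ω_re, ω_im] at ha hb
    have him : c.im = b * Real.sqrt 3 / 2 := by linarith
    apply Complex.ext
    · simp [ω_re]
      apply mul_left_cancel₀ s3_ne
      rw [him] at ha
      linear_combination ha
    · simp [ω_im, him]; ring
  rw [this]
  exact lin_mem _ _

theorem mk_rep {I : Ideal OK} (x : OK ⧸ I) : Ideal.Quotient.mk I (rep x) = x :=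
  Function.surjInv_eq Ideal.Quotient.mk_surjective x

theorem eC_congr (c a b : OK) (hc : c ≠ 0)
    (h : Ideal.Quotient.mk (Ideal.span {c}) a = Ideal.Quotient.mk (Ideal.span {c}) b) :
    eC ((a : ℂ) / c) = eC ((b : ℂ) / c) := by
  rw [Ideal.Quotient.mk_eq_mk_iff_sub_mem, Ideal.mem_span_singleton] at h
  obtain ⟨d, hd⟩ := h
  have ha : a = b + c * d := by linear_combination hd
  have hc' : (c : ℂ) ≠ 0 := by simpa using hc
  have : (a : ℂ) / c = b / c + d := by
    rw [ha]; push_cast; field_simp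
  rw [this, eC_add, eC_int, mul_one]

/-- additive character on the quotient -/
def EQ (c : OK) (x : OK ⧸ Ideal.span {c}) : ℂ := eC ((rep x : ℂ) / c)

theorem EQ_mk (c a : OK) (hc : c ≠ 0) : eC ((a : ℂ) / c) = EQ c (Ideal.Quotient.mk _ a) :=
  eC_congr c _ _ hc (mk_rep _).symm

theorem EQ_add (c : OK) (hc : c ≠ 0) (x y : OK ⧸ Ideal.span {c}) :
    EQ c (x + y) = EQ c x * EQ c y := by
  conv_lhs => rw [← mk_rep x, ← mk_rep y, ← map_add, ← EQ_mk _ _ hc]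
  rw [EQ, EQ, ← eC_add]
  congr 1
  push_cast
  ring

theorem EQ_zero (c : OK) (hc : c ≠ 0) : EQ c 0 = 1 := by
  rw [← map_zero (Ideal.Quotient.mk _), ← EQ_mk _ _ hc]
  simpa using eC_int 0

theorem eC_nontriv (p : OK) (hp : Prime p) : ∃ z : OK, eC ((z : ℂ) / p) ≠ 1 := by
  by_contra! h
  have h1 := eC_nondeg ((p : ℂ)⁻¹) (fun z => by rw [← h z, div_eq_mul_inv])
  have hc' : (p : ℂ) ≠ 0 := by simpa using hp.ne_zero
  exact hp.not_isUnit (IsUnit.of_mul_eq_one (⟨_, h1⟩ : OK) (Subtype.ext (by simp [hc'])))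

/-! Units modulo prime powers -/

theorem coprime_of_not_dvd (p a : OK) (hp : Prime p) (h : ¬ p ∣ a) : IsCoprime a p := by
  have : Finite (OK ⧸ Ideal.span {p}) := finQ p hp.ne_zero
  have : (Ideal.span {p}).IsPrime := (Ideal.span_singleton_prime hp.ne_zero).2 hp
  have hf := Finite.isField_of_domain (OK ⧸ Ideal.span {p})
  have ha : Ideal.Quotient.mk (Ideal.span {p}) a ≠ 0 := by
    rwa [Ne, Ideal.Quotient.eq_zero_iff_mem, Ideal.mem_span_singleton]
  obtain ⟨b, hb⟩ := hf.mul_inv_cancel ha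
  obtain ⟨b, rfl⟩ := Ideal.Quotient.mk_surjective b
  rw [← map_mul, ← map_one (Ideal.Quotient.mk _), Ideal.Quotient.mk_eq_mk_iff_sub_mem,
    Ideal.mem_span_singleton] at hb
  obtain ⟨d, hd⟩ := hb
  exact ⟨b, -d, by linear_combination hd⟩

theorem unit_of_coprime (c a : OK) (h : IsCoprime a c) :
    IsUnit (Ideal.Quotient.mk (Ideal.span {c}) a) := by
  obtain ⟨x, y, hxy⟩ := h
  refine IsUnit.of_mul_eq_one (Ideal.Quotient.mk _ x) ?_
  rw [← map_mul, ← map_one (Ideal.Quotient.mk _), Ideal.Quotient.mk_eq_mk_iff_sub_mem,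
    Ideal.mem_span_singleton]
  exact ⟨-y, by linear_combination hxy⟩

theorem not_dvd_of_unit (p a : OK) (hp : Prime p)
    (h : IsUnit (Ideal.Quotient.mk (Ideal.span {p}) a)) : ¬ p ∣ a := by
  intro hd
  have : (Ideal.span {p}).IsPrime := (Ideal.span_singleton_prime hp.ne_zero).2 hp
  have : Ideal.Quotient.mk (Ideal.span {p}) a = 0 := by
    rwa [Ideal.Quotient.eq_zero_iff_mem, Ideal.mem_span_singleton]
  rw [this] at h
  exact not_isUnit_zero h

/-! The cubic character -/

theorem not_dvd_three (p : OK) (hp : Prime p) (hp3 : (3 : OK) ∣ p - 1) : ¬ p ∣ 3 := by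
  intro h
  have h1 := h.trans hp3
  exact hp.not_isUnit (isUnit_of_dvd_one (by simpa using dvd_sub (dvd_refl p) h1))

theorem root_unique (p : OK) (hp : Prime p) (hp3 : (3 : OK) ∣ p - 1) (x y : OK)
    (hx : x ^ 3 = 1) (hy : y ^ 3 = 1) (h : p ∣ x - y) : x = y := by
  by_contra hne
  have h1 : (x - y) * (x ^ 2 + x * y + y ^ 2) = 0 := by linear_combination hx - hy
  have h2 : x ^ 2 + x * y + y ^ 2 = 0 := (mul_eq_zero.1 h1).resolve_left (sub_ne_zero.2 hne)
  apply not_dvd_three p hp hp3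
  have h3 : (3 : OK) = (x - y) * (-y * (x + 2 * y)) := by
    linear_combination (-3) * hy + y * h2
  rw [h3]
  exact h.mul_right _

theorem card_div (p : OK) (hp : Prime p) (hp3 : (3 : OK) ∣ p - 1) : 3 ∣ Nm p - 1 ∧ 1 < Nm p := by
  have : Finite (OK ⧸ Ideal.span {p}) := finQ p hp.ne_zero
  have : (Ideal.span {p}).IsPrime := (Ideal.span_singleton_prime hp.ne_zero).2 hp
  let : Field (OK ⧸ Ideal.span {p}) := (Finite.isField_of_domain (OK ⧸ Ideal.span {p})).toField
  have hw3 : wO ^ 3 = 1 := by linear_combination (wO - 1) * wO_sq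
  refine ⟨?_, Finite.one_lt_card⟩
  rw [Nm, ← Nat.card_units]
  set m := Ideal.Quotient.mk (Ideal.span {p}) wO with hm
  have hm3 : m ^ 3 = 1 := by rw [hm, ← map_pow, hw3, map_one]
  have hm1 : m ≠ 1 := by
    intro h
    rw [hm, ← map_one (Ideal.Quotient.mk _), Ideal.Quotient.mk_eq_mk_iff_sub_mem,
      Ideal.mem_span_singleton] at h
    have := root_unique p hp hp3 _ _ hw3 (one_pow 3) h
    apply not_dvd_three p hp hp3
    have h2 := wO_sq
    rw [this] at h2
    have : (3 : OK) = 0 := by linear_combination h2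
    rw [this]; exact dvd_zero p
  let u : (OK ⧸ Ideal.span {p})ˣ := Units.ofPowEqOne m 3 hm3 (by norm_num)
  have hu : orderOf u = 3 := by
    apply orderOf_eq_prime
    · exact Units.pow_ofPowEqOne _ _
    · intro h; apply hm1
      have := congrArg Units.val h
      simpa [u] using this
  rw [← hu]
  exact orderOf_dvd_natCard u

theorem pow_card (p : OK) (hp : Prime p) (hp3 : (3 : OK) ∣ p - 1) (x : OK) (hx : ¬ p ∣ x) :
    ∃ ζ : OK, ζ ^ 3 = 1 ∧ p ∣ ζ - x ^ ((Nm p - 1) / 3) := by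
  have : Finite (OK ⧸ Ideal.span {p}) := finQ p hp.ne_zero
  have : (Ideal.span {p}).IsPrime := (Ideal.span_singleton_prime hp.ne_zero).2 hp
  let : Field (OK ⧸ Ideal.span {p}) := (Finite.isField_of_domain (OK ⧸ Ideal.span {p})).toField
  have hw3 : wO ^ 3 = 1 := by linear_combination (wO - 1) * wO_sq
  obtain ⟨hd, -⟩ := card_div p hp hp3
  have hu := unit_of_coprime p x (coprime_of_not_dvd p x hp hx)
  set y := x ^ ((Nm p - 1) / 3) with hy
  have hy3 : p ∣ y ^ 3 - 1 := by
    rw [hy, ← pow_mul, Nat.div_mul_cancel hd, ← Ideal.mem_span_singleton,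
      ← Ideal.Quotient.mk_eq_mk_iff_sub_mem, map_pow, map_one, Nm, ← Nat.card_units]
    obtain ⟨v, hv⟩ := hu
    rw [← hv, ← Units.val_pow_eq_pow_val, pow_card_eq_one', Units.val_one]
  have hf : y ^ 3 - 1 = (1 - y) * ((wO - y) * (wO ^ 2 - y)) * (-1) := by
    linear_combination (1 - y) * (hw3 - y * wO_sq)
  rw [hf, mul_neg_one, dvd_neg] at hy3
  rcases hp.dvd_or_dvd hy3 with h | h
  · exact ⟨1, one_pow 3, h⟩
  rcases hp.dvd_or_dvd h with h | h
  · exact ⟨wO, hw3, h⟩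
  · exact ⟨wO ^ 2, by linear_combination (wO ^ 3 + 1) * hw3, h⟩

theorem cc_spec (p : OK) (hp : Prime p) (hp3 : (3 : OK) ∣ p - 1) (x : OK) (hx : ¬ p ∣ x) :
    cubicCharP p x ^ 3 = 1 ∧ p ∣ cubicCharP p x - x ^ ((Nm p - 1) / 3) := by
  have h : ∃ ζ : OK, ζ ^ 3 = 1 ∧ p ∣ ζ - x ^ ((Nm p - 1) / 3) ∧ ¬ p ∣ x := by
    obtain ⟨ζ, h1, h2⟩ := pow_card p hp hp3 x hx
    exact ⟨ζ, h1, h2, hx⟩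
  rw [cubicCharP, dif_pos h]
  exact ⟨h.choose_spec.1, h.choose_spec.2.1⟩

theorem cc_eq (p : OK) (hp : Prime p) (hp3 : (3 : OK) ∣ p - 1) (x : OK) (hx : ¬ p ∣ x) (ζ : OK)
    (h1 : ζ ^ 3 = 1) (h2 : p ∣ ζ - x ^ ((Nm p - 1) / 3)) : cubicCharP p x = ζ := by
  obtain ⟨h3, h4⟩ := cc_spec p hp hp3 x hx
  exact root_unique p hp hp3 _ _ h3 h1 (by simpa using dvd_sub h4 h2)

theorem cc_congr (p : OK) (hp : Prime p) (hp3 : (3 : OK) ∣ p - 1) (x y : OK) (hx : ¬ p ∣ x)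
    (h : p ∣ x - y) : cubicCharP p x = cubicCharP p y := by
  have hy : ¬ p ∣ y := fun hy => hx (by simpa using dvd_add h hy)
  obtain ⟨h3, h4⟩ := cc_spec p hp hp3 y hy
  refine cc_eq p hp hp3 x hx _ h3 ?_
  have := h.trans (sub_dvd_pow_sub_pow x y ((Nm p - 1) / 3))
  simpa using dvd_sub h4 this

theorem cc_mul (p : OK) (hp : Prime p) (hp3 : (3 : OK) ∣ p - 1) (x y : OK) (hx : ¬ p ∣ x)
    (hy : ¬ p ∣ y) : cubicCharP p (x * y) = cubicCharP p x * cubicCharP p y := by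
  obtain ⟨h1, h2⟩ := cc_spec p hp hp3 x hx
  obtain ⟨h3, h4⟩ := cc_spec p hp hp3 y hy
  refine cc_eq p hp hp3 _ (fun h => (hp.dvd_or_dvd h).elim hx hy) _ ?_ ?_
  · rw [mul_pow, h1, h3, one_mul]
  · have := dvd_add (h2.mul_right (cubicCharP p y)) (h4.mul_left (x ^ ((Nm p - 1) / 3)))
    convert this using 1
    ring

theorem cc_assoc (p q : OK) (h : Associated p q) (x : OK) :
    cubicCharP p x = cubicCharP q x := by
  have hN : Nm p = Nm q := by
    rw [Nm, Nm, Ideal.span_singleton_eq_span_singleton.2 h]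
  have : ∀ ζ : OK, (ζ ^ 3 = 1 ∧ p ∣ ζ - x ^ ((Nm p - 1) / 3) ∧ ¬ p ∣ x) =
      (ζ ^ 3 = 1 ∧ q ∣ ζ - x ^ ((Nm q - 1) / 3) ∧ ¬ q ∣ x) := by
    intro ζ
    rw [hN, h.dvd_iff_dvd_left, h.dvd_iff_dvd_left]
  unfold cubicCharP
  simp only [this]

theorem cubicChar_prime (p x : OK) (hp : Prime p) : cubicChar p x = cubicCharP p x := by
  have h : ∃ fs : OKˣ × Multiset OK, (∀ π ∈ fs.2, Prime π) ∧ p = (fs.1 : OK) * fs.2.prod :=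
    ⟨(1, {p}), by simpa using hp, by simp⟩
  rw [cubicChar, dif_pos h]
  obtain ⟨h1, h2⟩ := h.choose_spec
  have h3 : Multiset.Rel Associated h.choose.2 {p} := by
    refine prime_factors_unique h1 (by simpa using hp) ?_
    refine ⟨h.choose.1, ?_⟩
    rw [Multiset.prod_singleton, mul_comm]
    exact h2.symm
  rw [← Multiset.cons_zero, Multiset.rel_cons_right] at h3
  obtain ⟨a, s, ha, hs, hfs⟩ := h3
  rw [Multiset.rel_zero_right] at hs
  rw [hfs, hs]
  simpa using cc_assoc a p ha x

theorem moebius_prime (p : OK) (hp : Prime p) : moebius p = -1 := by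
  have hI : (Ideal.span {p}).IsPrime := (Ideal.span_singleton_prime hp.ne_zero).2 hp
  have hdvd : ∀ J : Ideal OK, Ideal.span {p} ∣ J ↔ J ≤ Ideal.span {p} := by
    intro J
    refine ⟨Ideal.le_of_dvd, fun h => ?_⟩
    refine ⟨Submodule.comap (LinearMap.mulLeft OK p) J, le_antisymm ?_ ?_⟩
    · intro x hx
      obtain ⟨z, rfl⟩ := Ideal.mem_span_singleton.1 (h hx)
      exact Ideal.mem_span_singleton_mul.2 ⟨z, hx, rfl⟩
    · intro x hx
      obtain ⟨z, hz, rfl⟩ := Ideal.mem_span_singleton_mul.1 hx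
      exact hz
  have hIp : Prime (Ideal.span {p}) := by
    refine ⟨by simpa using hp.ne_zero, ?_, ?_⟩
    · rw [Ideal.isUnit_iff]; exact hI.ne_top
    · intro J K h
      rw [hdvd] at h ⊢
      rw [hdvd]
      exact hI.mul_le.1 h
  have h : ∃ s : Finset (Ideal OK), (∀ P ∈ s, Prime P) ∧ Ideal.span {p} = ∏ P ∈ s, P :=
    ⟨{Ideal.span {p}}, by simpa using hIp, by simp⟩
  rw [moebius, dif_pos h]
  obtain ⟨h1, h2⟩ := h.choose_spec
  generalize h.choose = s at h1 h2
  obtain ⟨P, hPs, hP⟩ := hIp.exists_mem_finset_dvd (dvd_of_eq h2)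
  have hPe : P = Ideal.span {p} :=
    le_antisymm (Ideal.le_of_dvd hP) (Ideal.le_of_dvd ((Finset.dvd_prod_of_mem (fun P => P) hPs).trans (dvd_of_eq h2.symm)))
  have hrest : ∏ Q ∈ s.erase P, Q = 1 := by
    rw [← Finset.mul_prod_erase _ _ hPs, hPe] at h2
    have h3 : Ideal.span {p} * 1 = Ideal.span {p} * ∏ Q ∈ s.erase (Ideal.span {p}), Q := by
      rw [mul_one]; exact h2
    rw [Ideal.span_singleton_mul_right_inj hp.ne_zero] at h3
    rw [hPe]; exact h3.symm
  have hem : s.erase P = ∅ := by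
    rw [Finset.eq_empty_iff_forall_notMem]
    intro Q hQ
    have : Q ∣ 1 := hrest ▸ Finset.dvd_prod_of_mem (fun Q => Q) hQ
    exact (h1 Q (Finset.mem_of_mem_erase hQ)).not_isUnit (isUnit_of_dvd_one this)
  have hs : s.card = 1 := by
    rw [← Finset.card_erase_add_one hPs, hem]; simp
  rw [hs]; norm_num

theorem part_gt (p w B : OK) (hp : Prime p) (hp3 : (3 : OK) ∣ p - 1)
    (hco : IsCoprime (w * B) p) (l k : ℕ) (hlk : k ≤ l) (hk : 1 < k) :
      ∑ᶠ u : (OK ⧸ Ideal.span {p ^ k})ˣ,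
        ((cubicCharP p (rep u.val) ^ k : OK) : ℂ) *
          eC (((p ^ l * invMod (p ^ k) (w * rep u.val) : OK) : ℂ) / ((p ^ k : OK) : ℂ)) *
          ∑ᶠ t : OK ⧸ Ideal.span {p ^ k},
            eC (((rep u.val * w ^ 2 * rep t ^ 3 + B * rep t : OK) : ℂ) /
              ((p ^ k : OK) : ℂ)) = 0 := by
  have hc : p ^ k ≠ 0 := pow_ne_zero _ hp.ne_zero
  have : Finite (OK ⧸ Ideal.span {p ^ k}) := finQ _ hc
  have : Fintype (OK ⧸ Ideal.span {p ^ k}) := Fintype.ofFinite _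
  have hzero : ∀ a : OK, Ideal.Quotient.mk (Ideal.span {p ^ k}) a = 0 ↔ p ^ k ∣ a := fun a => by
    rw [Ideal.Quotient.eq_zero_iff_mem, Ideal.mem_span_singleton]
  have hkk : p ^ k = p ^ (k - 1) * p := by rw [← pow_succ]; congr 1; omega
  have hdu : ∀ u : (OK ⧸ Ideal.span {p ^ k})ˣ, ¬ p ∣ rep u.val := by
    intro u hd
    have h2 : p ^ k ∣ rep u.val ^ k := pow_dvd_pow_of_dvd hd k
    rw [← hzero, map_pow, mk_rep, ← Units.val_pow_eq_pow_val] at h2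
    have h3 := (u ^ k).isUnit
    rw [h2, isUnit_zero_iff, ← map_zero (Ideal.Quotient.mk _), ← map_one (Ideal.Quotient.mk _),
      Ideal.Quotient.mk_eq_mk_iff_sub_mem, Ideal.mem_span_singleton, zero_sub, dvd_neg] at h3
    exact hp.not_isUnit (isUnit_of_dvd_one ((dvd_pow_self p (by omega)).trans h3))
  rw [finsum_eq_sum_of_fintype]
  have hcw : IsCoprime w (p ^ k) := (IsCoprime.of_mul_left_left hco).pow_right
  have hcB : IsCoprime B (p ^ k) := (IsCoprime.of_mul_left_right hco).pow_right
  have main := abs_gt (Ideal.Quotient.mk (Ideal.span {p ^ k}) (p ^ (k - 1)))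
    (Ideal.Quotient.mk _ w) (Ideal.Quotient.mk _ B) (EQ (p ^ k)) (EQ_add _ hc)
    (by rw [← map_mul, hzero, ← pow_add]; exact pow_dvd_pow p (by omega))
    (unit_of_coprime _ _ hcw) (unit_of_coprime _ _ hcB)
    (by
      intro t ht
      rw [← mk_rep t, ← map_mul, hzero]
      refine (dvd_of_eq hkk).trans (mul_dvd_mul_left _ ?_)
      by_contra hd
      apply ht
      rw [← mk_rep t]
      exact unit_of_coprime _ _ (coprime_of_not_dvd p _ hp hd).pow_right)
    (by
      obtain ⟨z, hz⟩ := eC_nontriv p hp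
      refine ⟨Ideal.Quotient.mk _ z, ?_⟩
      rw [← map_mul, ← EQ_mk _ _ hc]
      convert hz using 2
      have h1 : (p : ℂ) ≠ 0 := by simpa using hp.ne_zero
      rw [hkk]
      push_cast
      field_simp)
    (fun u => ((cubicCharP p (rep u.val) ^ k : OK) : ℂ))
    (by
      intro u v huv
      rw [cc_congr p hp hp3 _ (rep v.val) (hdu u) ?_]
      obtain ⟨z, hz⟩ := huv
      rw [← mk_rep u.val, ← mk_rep v.val, ← mk_rep z, ← map_mul, ← map_sub,
        Ideal.Quotient.mk_eq_mk_iff_sub_mem, Ideal.mem_span_singleton] at hz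
      have h1 : p ∣ p ^ k := dvd_pow_self p (by omega)
      have h2 : p ∣ p ^ (k - 1) * rep z := (dvd_pow_self p (by omega)).mul_right _
      simpa only [sub_add_cancel, mk_rep] using dvd_add (h1.trans hz) h2)
  rw [← main]
  refine Finset.sum_congr rfl fun u _ => ?_
  have h1 : eC (((p ^ l * invMod (p ^ k) (w * rep u.val) : OK) : ℂ) / ((p ^ k : OK) : ℂ)) = 1 := by
    rw [EQ_mk _ _ hc, map_mul, (hzero (p ^ l)).2 (pow_dvd_pow p hlk), zero_mul, EQ_zero _ hc]
  rw [h1, mul_one, finsum_eq_sum_of_fintype]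
  congr 1
  refine Finset.sum_congr rfl fun t _ => ?_
  rw [EQ_mk _ _ hc]
  simp only [map_add, map_mul, map_pow, mk_rep]

theorem part_one (p w B : OK) (hp : Prime p) (hp3 : (3 : OK) ∣ p - 1)
    (hco : IsCoprime (w * B) p) (l : ℕ) (hlk : 1 ≤ l) :
      ∑ᶠ u : (OK ⧸ Ideal.span {p})ˣ,
        ((cubicCharP p (rep u.val) : OK) : ℂ) *
          eC (((p ^ l * invMod p (w * rep u.val) : OK) : ℂ) / (p : ℂ)) *
          ∑ᶠ t : OK ⧸ Ideal.span {p},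
            eC (((rep u.val * w ^ 2 * rep t ^ 3 + B * rep t : OK) : ℂ) / (p : ℂ)) =
        (moebius p : ℂ) * ((cubicCharP p w : OK) : ℂ) * gaussSum 1 p := by
  have hc := hp.ne_zero
  have : Finite (OK ⧸ Ideal.span {p}) := finQ _ hc
  have : Fintype (OK ⧸ Ideal.span {p}) := Fintype.ofFinite _
  have : (Ideal.span {p}).IsPrime := (Ideal.span_singleton_prime hp.ne_zero).2 hp
  let _ : Field (OK ⧸ Ideal.span {p}) := (Finite.isField_of_domain (OK ⧸ Ideal.span {p})).toField
  have hdu : ∀ u : (OK ⧸ Ideal.span {p})ˣ, ¬ p ∣ rep u.val := by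
    intro u
    apply not_dvd_of_unit p _ hp
    rw [mk_rep]; exact u.isUnit
  have heq : ∀ a b : OK, Ideal.Quotient.mk (Ideal.span {p}) a = Ideal.Quotient.mk _ b ↔
      p ∣ a - b := fun a b => by
    rw [Ideal.Quotient.mk_eq_mk_iff_sub_mem, Ideal.mem_span_singleton]
  have hp1 : ¬ p ∣ 1 := fun h => hp.not_isUnit (isUnit_of_dvd_one h)
  let X : (OK ⧸ Ideal.span {p})ˣ →* ℂ :=
    { toFun := fun u => ((cubicCharP p (rep u.val) : OK) : ℂ)
      map_one' := by
        rw [cc_congr p hp hp3 _ 1 (hdu 1) ((heq _ _).1 (by rw [mk_rep]; simp)),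
          cc_eq p hp hp3 1 hp1 1 (one_pow 3) (by simp)]
        rfl
      map_mul' := fun u v => by
        rw [cc_congr p hp hp3 _ (rep u.val * rep v.val) (hdu _)
          ((heq _ _).1 (by rw [map_mul, mk_rep, mk_rep, mk_rep]; simp)),
          cc_mul p hp hp3 _ _ (hdu u) (hdu v)]
        rfl }
  have hXdef : ∀ u, X u = ((cubicCharP p (rep u.val) : OK) : ℂ) := fun u => rfl
  obtain ⟨w', hw'⟩ := unit_of_coprime _ _ (IsCoprime.of_mul_left_left hco)
  obtain ⟨B', hB'⟩ := unit_of_coprime _ _ (IsCoprime.of_mul_left_right hco)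
  have main := abs_one w' B' (EQ p) (EQ_add _ hc) (EQ_zero _ hc)
    (by
      obtain ⟨z, hz⟩ := eC_nontriv p hp
      exact ⟨Ideal.Quotient.mk _ z, by rwa [← EQ_mk _ _ hc]⟩) X
    (by
      intro u
      have h := (cc_spec p hp hp3 _ (hdu u)).1
      rw [hXdef]
      exact_mod_cast congrArg (Subtype.val) h)
    (by
      obtain ⟨g, hg⟩ := IsCyclic.exists_ofOrder_eq_natCard (α := (OK ⧸ Ideal.span {p})ˣ)
      obtain ⟨h3, h1⟩ := card_div p hp hp3
      refine ⟨g, fun hX => ?_⟩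
      rw [hXdef] at hX
      have hX' : cubicCharP p (rep g.val) = 1 := Subtype.ext hX
      have h := (cc_spec p hp hp3 _ (hdu g)).2
      rw [hX', ← heq, map_one, map_pow, mk_rep, ← Units.val_pow_eq_pow_val, ← Units.val_one] at h
      have h5 := orderOf_dvd_of_pow_eq_one (Units.ext h).symm
      rw [hg, Nat.card_units] at h5
      have h6 := Nat.le_of_dvd (by omega) h5
      change Nm p - 1 ≤ _ at h6
      omega)
  have hg : gaussSum 1 p = ∑ u, X u * EQ p u := by
    rw [gaussSum, finsum_eq_sum_of_fintype]
    refine Finset.sum_congr rfl fun u _ => ?_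
    rw [cubicChar_prime _ _ hp, EQ_mk _ _ hc, one_mul, mk_rep, hXdef]
  have hXw : X w' = ((cubicCharP p w : OK) : ℂ) := by
    rw [hXdef, cc_congr p hp hp3 _ w (hdu _) ((heq _ _).1 (by rw [mk_rep, hw']))]
  rw [hg, ← hXw, moebius_prime p hp, finsum_eq_sum_of_fintype]
  have hm : (((-1 : ℤ) : ℂ)) * X w' = - X w' := by push_cast; ring
  rw [hm, ← main]
  refine Finset.sum_congr rfl fun u _ => ?_
  have h1 : eC (((p ^ l * invMod p (w * rep u.val) : OK) : ℂ) / (p : ℂ)) = 1 := by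
    have h0 : Ideal.Quotient.mk (Ideal.span {p}) (p ^ l) = 0 := by
      rw [Ideal.Quotient.eq_zero_iff_mem, Ideal.mem_span_singleton]
      exact dvd_pow_self p (by omega)
    rw [EQ_mk _ _ hc, map_mul, h0, zero_mul, EQ_zero _ hc]
  rw [h1, mul_one, finsum_eq_sum_of_fintype, hXdef]
  congr 1
  refine Finset.sum_congr rfl fun t _ => ?_
  rw [EQ_mk _ _ hc]
  simp only [map_add, map_mul, map_pow, mk_rep, hw', hB']

/- Statement 7 -/
theorem stmt7 (p w B : OK) (hp : Prime p) (hp3 : (3 : OK) ∣ p - 1)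
    (hco : IsCoprime (w * B) p) (l k : ℕ) (hk : 1 ≤ k) (hlk : k ≤ l) :
    (1 < k →
      ∑ᶠ u : (OK ⧸ Ideal.span {p ^ k})ˣ,
        ((cubicCharP p (rep u.val) ^ k : OK) : ℂ) *
          eC (((p ^ l * invMod (p ^ k) (w * rep u.val) : OK) : ℂ) / ((p ^ k : OK) : ℂ)) *
          ∑ᶠ t : OK ⧸ Ideal.span {p ^ k},
            eC (((rep u.val * w ^ 2 * rep t ^ 3 + B * rep t : OK) : ℂ) /
              ((p ^ k : OK) : ℂ)) = 0) ∧
    (k = 1 →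
      ∑ᶠ u : (OK ⧸ Ideal.span {p})ˣ,
        ((cubicCharP p (rep u.val) : OK) : ℂ) *
          eC (((p ^ l * invMod p (w * rep u.val) : OK) : ℂ) / (p : ℂ)) *
          ∑ᶠ t : OK ⧸ Ideal.span {p},
            eC (((rep u.val * w ^ 2 * rep t ^ 3 + B * rep t : OK) : ℂ) / (p : ℂ)) =
        (moebius p : ℂ) * ((cubicCharP p w : OK) : ℂ) * gaussSum 1 p) := by
  refine ⟨part_gt p w B hp hp3 hco l k hlk, ?_⟩
  rintro rfl
  exact part_one p w B hp hp3 hco l hlk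

end CubicSeries
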